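/- Assume (A3). Let w₋, w₊ : Ī → ℝ be bounded weight functions with w₋ left-continuous, w₊ right-continuous, and w₋(I₋) = 0 = w₊(I₊), and let F be the associated linear functional on configurations. Then for every configuration X, GF(X) = q₋(M₋(X)) + q₊(M₊(X)), where q₋(x) := ∫_x^{I₊} w₊ dλ₊ − w₋(x)λ₊(x) and q₊(x) := −∫_{I₋}^x w₋ dλ₋ − w₊(x)λ₋(x) for x ∈ Ī. -/

import Mathlib

open MeasureTheory Set
open scoped ENNReal

noncomputable section

/-- The right limit of `f` at `x`, with the convention `f(b+) := f b` at the
right endpoint `b`. -/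
def rLim (b : ℝ) (f : ℝ → ℝ) (x : ℝ) : ℝ :=
  if x < b then Function.rightLim f x else f b

/-- `ν` is the Lebesgue-Stieltjes signed measure `df` of `f` on the interval `[a,b]`,
with the conventions `f(a−) := f a` and `f(b+) := f b`. -/
def IsLS (a b : ℝ) (f : ℝ → ℝ) (ν : MeasureTheory.SignedMeasure ℝ) : Prop :=
  (∀ s : Set ℝ, MeasurableSet s → s ∩ Set.Icc a b = ∅ → ν s = 0) ∧
  (∀ x y : ℝ, a ≤ x → x ≤ y → y ≤ b → ν (Set.Ioc x y) = rLim b f y - rLim b f x) ∧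
  ν {a} = rLim b f a - f a

/-- The integral `∫_s g dν` of `g` over `s` against the signed measure `ν`. -/
def sInt (ν : MeasureTheory.SignedMeasure ℝ) (g : ℝ → ℝ) (s : Set ℝ) : ℝ :=
  (∫ x in s, g x ∂ν.toJordanDecomposition.posPart) -
    ∫ x in s, g x ∂ν.toJordanDecomposition.negPart

/-- Assumption (A3): `lm` (demand) is continuous and nonincreasing, `lp` (supply) is
continuous and nondecreasing on `[a,b]`; both are nonnegative. -/
def A3 (a b : ℝ) (lm lp : ℝ → ℝ) : Prop :=
  ContinuousOn lm (Set.Icc a b) ∧ ContinuousOn lp (Set.Icc a b) ∧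
  AntitoneOn lm (Set.Icc a b) ∧ MonotoneOn lp (Set.Icc a b) ∧
  (∀ x ∈ Set.Icc a b, 0 ≤ lm x) ∧ (∀ x ∈ Set.Icc a b, 0 ≤ lp x)

/-- Assumption (A6): the rates of market orders are positive. -/
def A6 (a b : ℝ) (lm lp : ℝ → ℝ) : Prop := 0 < lp a ∧ 0 < lm b

/-- The state of the order book: the multiset of buy limit order prices and the
multiset of sell limit order prices. -/
structure OrderBook where
  minus : Multiset ℝ
  plus : Multiset ℝ

/-- A valid configuration on the interval `(a,b)`: all orders have prices in `(a,b)`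
and every buy order is strictly below every sell order. -/
def IsConfig (a b : ℝ) (X : OrderBook) : Prop :=
  (∀ x ∈ X.minus, x ∈ Set.Ioo a b) ∧ (∀ x ∈ X.plus, x ∈ Set.Ioo a b) ∧
  ∀ x ∈ X.minus, ∀ y ∈ X.plus, x < y

/-- The best (highest) buy offer, `a` if there are no buy limit orders. -/
def Mminus (a : ℝ) (X : OrderBook) : ℝ := sSup (insert a {x | x ∈ X.minus})

/-- The best (lowest) sell offer, `b` if there are no sell limit orders. -/
def Mplus (b : ℝ) (X : OrderBook) : ℝ := sInf (insert b {x | x ∈ X.plus})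

open scoped Classical in
/-- The Luckock map for a buy order at price level `u` (`u = b` is a buy market order). -/
def Lminus (a b u : ℝ) (X : OrderBook) : OrderBook :=
  if X.plus ≠ 0 ∧ Mplus b X ≤ u then ⟨X.minus, X.plus.erase (Mplus b X)⟩
  else if u ∈ Set.Ioo a b then ⟨u ::ₘ X.minus, X.plus⟩ else X

open scoped Classical in
/-- The Luckock map for a sell order at price level `u` (`u = a` is a sell market order). -/
def Lplus (a b u : ℝ) (X : OrderBook) : OrderBook :=
  if X.minus ≠ 0 ∧ u ≤ Mminus a X then ⟨X.minus.erase (Mminus a X), X.plus⟩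
  else if u ∈ Set.Ioo a b then ⟨X.minus, u ::ₘ X.plus⟩ else X

/-- The linear functional associated with the weight functions `wm, wp`. -/
def linF (wm wp : ℝ → ℝ) (X : OrderBook) : ℝ :=
  (X.minus.map wm).sum + (X.plus.map wp).sum

/-- The generator of the Stigler-Luckock model with arrival measures `μm, μp`. -/
def genOp (a b : ℝ) (μm μp : MeasureTheory.Measure ℝ) (F : OrderBook → ℝ)
    (X : OrderBook) : ℝ :=
  (∫ u, (F (Lminus a b u X) - F X) ∂μm) + ∫ u, (F (Lplus a b u X) - F X) ∂μp

/-- `μm` is the arrival measure of buy orders: `μm [x, b] = lm x`, supported on `[a,b]`. -/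
def IsMuMinus (a b : ℝ) (lm : ℝ → ℝ) (μm : MeasureTheory.Measure ℝ) : Prop :=
  (∀ x ∈ Set.Icc a b, μm (Set.Icc x b) = ENNReal.ofReal (lm x)) ∧
  μm (Set.Icc a b)ᶜ = 0

/-- `μp` is the arrival measure of sell orders: `μp [a, x] = lp x`, supported on `[a,b]`. -/
def IsMuPlus (a b : ℝ) (lp : ℝ → ℝ) (μp : MeasureTheory.Measure ℝ) : Prop :=
  (∀ x ∈ Set.Icc a b, μp (Set.Icc a x) = ENNReal.ofReal (lp x)) ∧
  μp (Set.Icc a b)ᶜ = 0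

/-- An admissible pair of weight functions: bounded, of bounded variation, `wm`
left-continuous, `wp` right-continuous, with `wm a = 0` and `wp b = 0`. -/
def WPair (a b : ℝ) (wm wp : ℝ → ℝ) : Prop :=
  (∃ C, ∀ x ∈ Set.Icc a b, |wm x| ≤ C) ∧ (∃ C, ∀ x ∈ Set.Icc a b, |wp x| ≤ C) ∧
  BoundedVariationOn wm (Set.Icc a b) ∧ BoundedVariationOn wp (Set.Icc a b) ∧
  (∀ x ∈ Set.Ioc a b, ContinuousWithinAt wm (Set.Iio x) x) ∧
  (∀ x ∈ Set.Ico a b, ContinuousWithinAt wp (Set.Ioi x) x) ∧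
  wm a = 0 ∧ wp b = 0

/-- The right-limit convention does not change a continuous function. -/
lemma rLim_eq_of_continuousOn {a b : ℝ} {f : ℝ → ℝ} (hf : ContinuousOn f (Icc a b)) {x : ℝ}
    (hx : x ∈ Icc a b) : rLim b f x = f x := by
  unfold rLim
  split_ifs with h
  · refine rightLim_eq_of_tendsto ((hf x hx).mono_left ?_)
    refine nhdsWithin_le_of_mem ?_
    filter_upwards [Ioc_mem_nhdsGT h] with y hy
    exact ⟨hx.1.trans hy.1.le, hy.2⟩
  · rw [le_antisymm (not_lt.1 h) hx.2]

/-- The Lebesgue-Stieltjes measure of a continuous function charges `(x,y]` with the increment. -/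
lemma IsLS.apply_Ioc {a b : ℝ} {f : ℝ → ℝ} {ν : SignedMeasure ℝ} (h : IsLS a b f ν)
    (hf : ContinuousOn f (Icc a b)) {x y : ℝ} (hx : a ≤ x) (hxy : x ≤ y) (hy : y ≤ b) :
    ν (Ioc x y) = f y - f x := by
  rw [h.2.1 x y hx hxy hy, rLim_eq_of_continuousOn hf ⟨hx.trans hxy, hy⟩,
    rLim_eq_of_continuousOn hf ⟨hx, hxy.trans hy⟩]

/-- The Lebesgue-Stieltjes measure of a continuous function vanishes off `(a,b]`. -/
lemma IsLS.apply_eq_zero {a b : ℝ} {f : ℝ → ℝ} {ν : SignedMeasure ℝ} (hab : a ≤ b)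
    (h : IsLS a b f ν) (hf : ContinuousOn f (Icc a b)) {s : Set ℝ} (hs : MeasurableSet s)
    (hd : Disjoint s (Ioc a b)) : ν s = 0 := by
  have h1 : ν (s \ {a}) = 0 := by
    refine h.1 _ (hs.diff (measurableSet_singleton a)) ?_
    ext x
    simp only [mem_inter_iff, Set.mem_sdiff, mem_singleton_iff, mem_Icc, mem_empty_iff_false,
      iff_false]
    rintro ⟨⟨h1, h2⟩, h3, h4⟩
    exact disjoint_left.1 hd h1 ⟨lt_of_le_of_ne h3 (Ne.symm h2), h4⟩
  by_cases ha : a ∈ s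
  · have hU : s = {a} ∪ (s \ {a}) := (union_sdiff_cancel (singleton_subset_iff.2 ha)).symm
    rw [hU, VectorMeasure.of_union disjoint_sdiff_right (measurableSet_singleton a)
      (hs.diff (measurableSet_singleton a)), h1, h.2.2,
      rLim_eq_of_continuousOn hf (left_mem_Icc.2 hab)]
    simp
  · rwa [sdiff_singleton_eq_self ha] at h1

/-- Two signed measures carried by `(a,b]` which agree on half-open subintervals are equal. -/
lemma signedMeasure_ext_of_Ioc {a b : ℝ} (hab : a ≤ b) {ν ν' : SignedMeasure ℝ}
    (h0 : ∀ s, MeasurableSet s → Disjoint s (Ioc a b) → ν s = 0)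
    (h0' : ∀ s, MeasurableSet s → Disjoint s (Ioc a b) → ν' s = 0)
    (h : ∀ x y, a ≤ x → x ≤ y → y ≤ b → ν (Ioc x y) = ν' (Ioc x y)) : ν = ν' := by
  have key : ∀ {ρ : SignedMeasure ℝ}, (∀ s, MeasurableSet s → Disjoint s (Ioc a b) → ρ s = 0) →
      ∀ s, MeasurableSet s → ρ s = ρ (s ∩ Ioc a b) := by
    intro ρ hρ s hs
    have := VectorMeasure.of_union (v := ρ) (A := s ∩ Ioc a b) (B := s \ Ioc a b)
      (disjoint_sdiff_right.mono_left inter_subset_right) (hs.inter measurableSet_Ioc)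
      (hs.diff measurableSet_Ioc)
    rw [inter_union_sdiff, hρ _ (hs.diff measurableSet_Ioc) disjoint_sdiff_left, add_zero] at this
    exact this
  have huniv : ν univ = ν' univ := by
    rw [key h0 _ MeasurableSet.univ, key h0' _ MeasurableSet.univ, univ_inter]
    exact h a b le_rfl hab le_rfl
  ext s hs
  induction s, hs using MeasurableSpace.induction_on_inter
    (borel_eq_generateFrom_Ioc ℝ ▸ BorelSpace.measurable_eq) (isPiSystem_Ioc id id) with
  | empty => simp
  | basic t ht =>
    obtain ⟨l, u, -, rfl⟩ := ht
    rw [id, id, key h0 _ measurableSet_Ioc, key h0' _ measurableSet_Ioc, Ioc_inter_Ioc]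
    rcases le_or_gt (max l a) (min u b) with hlu | hlu
    · exact h _ _ (le_max_right _ _) hlu (min_le_right _ _)
    · rw [Ioc_eq_empty hlu.not_gt]; simp
  | compl t ht ih =>
    rw [VectorMeasure.of_compl ht, VectorMeasure.of_compl ht, ih, huniv]
  | iUnion f hd hm ih =>
    rw [VectorMeasure.of_disjoint_iUnion hm hd, VectorMeasure.of_disjoint_iUnion hm hd]
    exact tsum_congr ih

/-- The Jordan decomposition of a finite positive measure. -/
lemma toJordanDecomposition_toSignedMeasure (μ : Measure ℝ) [IsFiniteMeasure μ] :
    μ.toSignedMeasure.toJordanDecomposition =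
      ⟨μ, 0, Measure.MutuallySingular.zero_right⟩ := by
  rw [← JordanDecomposition.toJordanDecomposition_toSignedMeasure
    ⟨μ, 0, Measure.MutuallySingular.zero_right⟩]
  congr 1
  simp [JordanDecomposition.toSignedMeasure]

lemma sInt_toSignedMeasure (μ : Measure ℝ) [IsFiniteMeasure μ] (g : ℝ → ℝ) (s : Set ℝ) :
    sInt μ.toSignedMeasure g s = ∫ x in s, g x ∂μ := by
  simp [sInt, toJordanDecomposition_toSignedMeasure]

lemma sInt_neg_toSignedMeasure (μ : Measure ℝ) [IsFiniteMeasure μ] (g : ℝ → ℝ) (s : Set ℝ) :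
    sInt (-μ.toSignedMeasure) g s = -∫ x in s, g x ∂μ := by
  simp [sInt, SignedMeasure.toJordanDecomposition_neg, toJordanDecomposition_toSignedMeasure]

/-- A function of bounded variation on `[a,b]` is integrable there for any finite measure. -/
lemma BoundedVariationOn.integrableOn_Icc {a b : ℝ} {w : ℝ → ℝ}
    (hw : BoundedVariationOn w (Icc a b)) {C : ℝ} (hC : ∀ x ∈ Icc a b, |w x| ≤ C)
    (μ : Measure ℝ) [IsFiniteMeasure μ] : IntegrableOn w (Icc a b) μ := by
  obtain ⟨p, q, hp, hq, rfl⟩ :=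
    hw.locallyBoundedVariationOn.exists_monotoneOn_sub_monotoneOn
  refine Integrable.of_bound (C := C) ?_ ?_
  · exact ((aemeasurable_restrict_of_monotoneOn measurableSet_Icc hp).sub
      (aemeasurable_restrict_of_monotoneOn measurableSet_Icc hq)).aestronglyMeasurable
  · exact (ae_restrict_iff' measurableSet_Icc).2 (Filter.Eventually.of_forall hC)

lemma isFiniteMeasure_of_Icc {a b : ℝ} {μ : Measure ℝ} (h1 : μ (Icc a b) ≠ ⊤)
    (h2 : μ (Icc a b)ᶜ = 0) : IsFiniteMeasure μ := by
  refine ⟨?_⟩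
  rw [← measure_add_measure_compl (μ := μ) (s := Icc a b) measurableSet_Icc, h2, add_zero]
  exact h1.lt_top

lemma bestBuy_finite (a : ℝ) (X : OrderBook) : (insert a {x | x ∈ X.minus}).Finite :=
  X.minus.finite_toSet.insert a

lemma bestSell_finite (b : ℝ) (X : OrderBook) : (insert b {x | x ∈ X.plus}).Finite :=
  X.plus.finite_toSet.insert b

lemma Mminus_mem (a : ℝ) (X : OrderBook) : Mminus a X = a ∨ Mminus a X ∈ X.minus :=
  (insert_nonempty _ _).csSup_mem (bestBuy_finite a X)

lemma Mplus_mem (b : ℝ) (X : OrderBook) : Mplus b X = b ∨ Mplus b X ∈ X.plus :=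
  (insert_nonempty _ _).csInf_mem (bestSell_finite b X)

lemma le_Mminus (a : ℝ) (X : OrderBook) {x : ℝ} (hx : x ∈ X.minus) : x ≤ Mminus a X :=
  le_csSup (bestBuy_finite a X).bddAbove (mem_insert_of_mem _ hx)

lemma left_le_Mminus (a : ℝ) (X : OrderBook) : a ≤ Mminus a X :=
  le_csSup (bestBuy_finite a X).bddAbove (mem_insert _ _)

lemma Mplus_le (b : ℝ) (X : OrderBook) {x : ℝ} (hx : x ∈ X.plus) : Mplus b X ≤ x :=
  csInf_le (bestSell_finite b X).bddBelow (mem_insert_of_mem _ hx)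

lemma Mplus_le_right (b : ℝ) (X : OrderBook) : Mplus b X ≤ b :=
  csInf_le (bestSell_finite b X).bddBelow (mem_insert _ _)

lemma Mminus_mem_minus {a b : ℝ} {X : OrderBook} (hX : IsConfig a b X) (h : X.minus ≠ 0) :
    Mminus a X ∈ X.minus := by
  refine (Mminus_mem a X).resolve_left fun hm => ?_
  obtain ⟨x, hx⟩ := Multiset.exists_mem_of_ne_zero h
  exact absurd (le_Mminus a X hx) (by rw [hm]; exact (hX.1 x hx).1.not_ge)

lemma Mplus_mem_plus {a b : ℝ} {X : OrderBook} (hX : IsConfig a b X) (h : X.plus ≠ 0) :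
    Mplus b X ∈ X.plus := by
  refine (Mplus_mem b X).resolve_left fun hm => ?_
  obtain ⟨x, hx⟩ := Multiset.exists_mem_of_ne_zero h
  exact absurd (Mplus_le b X hx) (by rw [hm]; exact (hX.2.1 x hx).2.not_ge)

lemma Mminus_lt_right {a b : ℝ} (hab : a < b) {X : OrderBook} (hX : IsConfig a b X) :
    Mminus a X < b := by
  rcases Mminus_mem a X with h | h
  · rwa [h]
  · exact (hX.1 _ h).2

lemma left_lt_Mplus {a b : ℝ} (hab : a < b) {X : OrderBook} (hX : IsConfig a b X) :
    a < Mplus b X := by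
  rcases Mplus_mem b X with h | h
  · rwa [h]
  · exact (hX.2.1 _ h).1

/-- The increment of a linear functional under the arrival of a buy order. -/
lemma linF_Lminus_sub {a b : ℝ} (hab : a < b) {X : OrderBook} (hX : IsConfig a b X)
    {wm wp : ℝ → ℝ} (hwp : wp b = 0) {u : ℝ} (hu : u ∈ Icc a b) :
    linF wm wp (Lminus a b u X) - linF wm wp X =
      (Ioo a (Mplus b X)).indicator wm u +
        (Icc (Mplus b X) b).indicator (fun _ => -wp (Mplus b X)) u := by
  have hp := left_lt_Mplus hab hX
  have hpb := Mplus_le_right b X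
  by_cases hup : Mplus b X ≤ u
  · rw [indicator_of_notMem (s := Ioo _ _) (fun h => h.2.not_ge hup),
      indicator_of_mem (s := Icc _ _) ⟨hup, hu.2⟩, zero_add]
    by_cases h0 : X.plus = 0
    · have hpb' : Mplus b X = b := by simp [Mplus, h0]
      have hub : u = b := le_antisymm hu.2 (hpb' ▸ hup)
      simp [Lminus, h0, hub, hpb', hwp]
    · have := Multiset.sum_map_erase (f := wp) (Mplus_mem_plus hX h0)
      rw [Lminus, if_pos ⟨h0, hup⟩]
      simp only [linF]
      linarith
  · rw [indicator_of_notMem (s := Icc _ _) (fun h => hup h.1), add_zero, Lminus,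
      if_neg (fun h => hup h.2)]
    rw [not_le] at hup
    rcases eq_or_lt_of_le hu.1 with rfl | hau
    · simp
    · rw [if_pos ⟨hau, hup.trans_le hpb⟩, indicator_of_mem (s := Ioo _ _) ⟨hau, hup⟩]
      simp [linF]

/-- The increment of a linear functional under the arrival of a sell order. -/
lemma linF_Lplus_sub {a b : ℝ} (hab : a < b) {X : OrderBook} (hX : IsConfig a b X)
    {wm wp : ℝ → ℝ} (hwm : wm a = 0) (hwp : wp b = 0) {u : ℝ} (hu : u ∈ Icc a b) :
    linF wm wp (Lplus a b u X) - linF wm wp X =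
      (Ioc (Mminus a X) b).indicator wp u +
        (Icc a (Mminus a X)).indicator (fun _ => -wm (Mminus a X)) u := by
  have hm := Mminus_lt_right hab hX
  have ham := left_le_Mminus a X
  by_cases hum : u ≤ Mminus a X
  · rw [indicator_of_notMem (s := Ioc _ _) (fun h => h.1.not_ge hum),
      indicator_of_mem (s := Icc _ _) ⟨hu.1, hum⟩, zero_add]
    by_cases h0 : X.minus = 0
    · have hma : Mminus a X = a := by simp [Mminus, h0]
      have hua : u = a := le_antisymm (hma ▸ hum) hu.1
      simp [Lplus, h0, hua, hma, hwm]
    · have := Multiset.sum_map_erase (f := wm) (Mminus_mem_minus hX h0)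
      rw [Lplus, if_pos ⟨h0, hum⟩]
      simp only [linF]
      linarith
  · rw [indicator_of_notMem (s := Icc _ _) (fun h => hum h.2), add_zero, Lplus,
      if_neg (fun h => hum h.2)]
    rw [not_le] at hum
    rw [indicator_of_mem (s := Ioc _ _) ⟨hum, hu.2⟩]
    rcases eq_or_lt_of_le hu.2 with rfl | hub
    · simp [hwp]
    · rw [if_pos ⟨ham.trans_lt hum, hub⟩]
      simp [linF]

lemma integral_indicator_add_const {μ : Measure ℝ} [IsFiniteMeasure μ] {s t : Set ℝ}
    (hs : MeasurableSet s) (ht : MeasurableSet t) {f g : ℝ → ℝ} {c : ℝ} (hg : IntegrableOn g s μ)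
    (h : ∀ᵐ u ∂μ, f u = s.indicator g u + t.indicator (fun _ => c) u) :
    ∫ u, f u ∂μ = (∫ u in s, g u ∂μ) + c * μ.real t := by
  rw [integral_congr_ae h, integral_add (hg.integrable_indicator hs)
    ((integrable_const c).indicator ht), integral_indicator hs, integral_indicator ht,
    setIntegral_const, smul_eq_mul, mul_comm c]

/-- The Lebesgue-Stieltjes measure of the supply function is the arrival measure on `(a,b]`. -/
lemma IsLS.eq_toSignedMeasure {a b : ℝ} (hab : a ≤ b) {lp : ℝ → ℝ}
    (hc : ContinuousOn lp (Icc a b)) (h0 : ∀ x ∈ Icc a b, 0 ≤ lp x)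
    {μ : Measure ℝ} [IsFiniteMeasure μ] (hμ : IsMuPlus a b lp μ) {ν : SignedMeasure ℝ}
    (hν : IsLS a b lp ν) : ν = (μ.restrict (Ioc a b)).toSignedMeasure := by
  have hreal : ∀ x ∈ Icc a b, μ.real (Icc a x) = lp x := fun x hx => by
    rw [Measure.real, hμ.1 x hx, ENNReal.toReal_ofReal (h0 x hx)]
  refine signedMeasure_ext_of_Ioc hab (fun s hs hd => hν.apply_eq_zero hab hc hs hd)
    (fun s hs hd => ?_) (fun x y hx hxy hy => ?_)
  · rw [Measure.toSignedMeasure_apply_measurable hs, measureReal_restrict_apply hs, hd.inter_eq,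
      measureReal_empty]
  · rw [hν.apply_Ioc hc hx hxy hy, Measure.toSignedMeasure_apply_measurable measurableSet_Ioc,
      measureReal_restrict_apply measurableSet_Ioc,
      inter_eq_left.2 (Ioc_subset_Ioc hx hy), ← hreal y ⟨hx.trans hxy, hy⟩,
      ← hreal x ⟨hx, hxy.trans hy⟩, ← Icc_union_Ioc_eq_Icc hx hxy,
      measureReal_union (disjoint_left.2 fun z h1 h2 => h2.1.not_ge h1.2) measurableSet_Ioc]
    ring

lemma IsMuMinus.real_Ico {a b : ℝ} {lm : ℝ → ℝ} (h0 : ∀ x ∈ Icc a b, 0 ≤ lm x)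
    {μ : Measure ℝ} [IsFiniteMeasure μ] (hμ : IsMuMinus a b lm μ) {x y : ℝ} (hx : a ≤ x)
    (hxy : x ≤ y) (hy : y ≤ b) : μ.real (Ico x y) = lm x - lm y := by
  have hreal : ∀ x ∈ Icc a b, μ.real (Icc x b) = lm x := fun x hx => by
    rw [Measure.real, hμ.1 x hx, ENNReal.toReal_ofReal (h0 x hx)]
  rw [← hreal y ⟨hx.trans hxy, hy⟩, ← hreal x ⟨hx, hxy.trans hy⟩, ← Ico_union_Icc_eq_Icc hxy hy,
    measureReal_union (disjoint_left.2 fun z h1 h2 => h1.2.not_ge h2.1) measurableSet_Icc]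
  ring

/-- The arrival measure of buy orders has no atoms except possibly at `b`. -/
lemma IsMuMinus.restrict_real_singleton {a b : ℝ} {lm : ℝ → ℝ}
    (hc : ContinuousOn lm (Icc a b)) (h0 : ∀ x ∈ Icc a b, 0 ≤ lm x)
    {μ : Measure ℝ} [IsFiniteMeasure μ] (hμ : IsMuMinus a b lm μ) (x : ℝ) :
    (μ.restrict (Ico a b)).real {x} = 0 := by
  rw [measureReal_restrict_apply (measurableSet_singleton x)]
  by_cases hx : x ∈ Ico a b
  · rw [inter_eq_left.2 (singleton_subset_iff.2 hx)]
    refine le_antisymm ?_ measureReal_nonneg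
    have ht : Filter.Tendsto (fun y => lm x - lm y) (nhdsWithin x (Ioi x))
        (nhds (lm x - lm x)) := by
      refine tendsto_const_nhds.sub ((hc x (Ico_subset_Icc_self hx)).mono_left ?_)
      refine nhdsWithin_le_of_mem ?_
      filter_upwards [Ioc_mem_nhdsGT hx.2] with y hy
      exact ⟨hx.1.trans hy.1.le, hy.2⟩
    rw [sub_self] at ht
    refine ge_of_tendsto ht ?_
    filter_upwards [Ioc_mem_nhdsGT hx.2] with y hy
    rw [← hμ.real_Ico h0 hx.1 hy.1.le hy.2]
    exact measureReal_mono (singleton_subset_iff.2 ⟨le_rfl, hy.1⟩)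
  · rw [singleton_inter_eq_empty.2 hx, measureReal_empty]

/-- The Lebesgue-Stieltjes measure of the demand function is minus the arrival measure
on `[a,b)`. -/
lemma IsLS.eq_neg_toSignedMeasure {a b : ℝ} (hab : a ≤ b) {lm : ℝ → ℝ}
    (hc : ContinuousOn lm (Icc a b)) (h0 : ∀ x ∈ Icc a b, 0 ≤ lm x)
    {μ : Measure ℝ} [IsFiniteMeasure μ] (hμ : IsMuMinus a b lm μ) {ν : SignedMeasure ℝ}
    (hν : IsLS a b lm ν) : ν = -(μ.restrict (Ico a b)).toSignedMeasure := by
  have hat := hμ.restrict_real_singleton hc h0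
  refine signedMeasure_ext_of_Ioc hab (fun s hs hd => hν.apply_eq_zero hab hc hs hd)
    (fun s hs hd => ?_) (fun x y hx hxy hy => ?_)
  · rw [neg_apply, Measure.toSignedMeasure_apply_measurable hs, neg_eq_zero]
    refine le_antisymm ?_ measureReal_nonneg
    rw [← hat a, measureReal_restrict_apply hs,
      measureReal_restrict_apply (measurableSet_singleton a)]
    refine measureReal_mono fun z hz => ⟨?_, hz.2⟩
    by_contra hza
    exact disjoint_left.1 hd hz.1 ⟨lt_of_le_of_ne hz.2.1 (Ne.symm hza), hz.2.2.le⟩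
  · rw [hν.apply_Ioc hc hx hxy hy, neg_apply,
      Measure.toSignedMeasure_apply_measurable measurableSet_Ioc, eq_neg_iff_add_eq_zero]
    have h1 : (μ.restrict (Ico a b)).real (Ico x y) = lm x - lm y := by
      rw [measureReal_restrict_apply measurableSet_Ico,
        inter_eq_left.2 (Ico_subset_Ico hx hy), hμ.real_Ico h0 hx hxy hy]
    have h2 := measureReal_union (μ := μ.restrict (Ico a b)) (s₁ := Ico x y) (s₂ := {y})
      (by simp) (measurableSet_singleton y)
    have h3 := measureReal_union (μ := μ.restrict (Ico a b)) (s₁ := {x}) (s₂ := Ioc x y)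
      (by simp) measurableSet_Ioc
    rw [Ico_union_right hxy] at h2
    rw [singleton_union, Ioc_insert_left hxy, hat] at h3
    rw [hat] at h2
    linarith

/-- generator on linear functionals: under (A3), for an admissible pair
of weight functions `(wm, wp)` with associated linear functional `F = linF wm wp`, one
has `GF(X) = q₋(M₋(X)) + q₊(M₊(X))` for every configuration `X`, where
`q₋(x) = ∫_{(x,b]} wp dλ₊ − wm(x)·lp(x)` and `q₊(x) = −∫_{(a,x]} wm dλ₋ − wp(x)·lm(x)`.
Here `μm, μp` are the arrival measures and `νlm, νlp` the Lebesgue-Stieltjes measures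
of `λ₋, λ₊` on `[a,b]`. -/
theorem stmt5 (a b : ℝ) (hab : a < b) (lm lp : ℝ → ℝ) (hA3 : A3 a b lm lp)
    (μm μp : MeasureTheory.Measure ℝ)
    (hμm : IsMuMinus a b lm μm) (hμp : IsMuPlus a b lp μp)
    (νlm νlp : MeasureTheory.SignedMeasure ℝ)
    (hνlm : IsLS a b lm νlm) (hνlp : IsLS a b lp νlp)
    (wm wp : ℝ → ℝ) (hW : WPair a b wm wp) :
    ∀ X : OrderBook, IsConfig a b X →
      genOp a b μm μp (linF wm wp) X =
        (sInt νlp wp (Set.Ioc (Mminus a X) b) - wm (Mminus a X) * lp (Mminus a X)) +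
        (- sInt νlm wm (Set.Ioc a (Mplus b X)) - wp (Mplus b X) * lm (Mplus b X)) := by
  intro X hX
  obtain ⟨hcm, hcp, -, -, h0m, h0p⟩ := hA3
  obtain ⟨⟨Cm, hCm⟩, ⟨Cp, hCp⟩, hvm, hvp, -, -, hwm, hwp⟩ := hW
  have : IsFiniteMeasure μm := isFiniteMeasure_of_Icc (a := a) (b := b)
    (by rw [hμm.1 a (left_mem_Icc.2 hab.le)]; exact ENNReal.ofReal_ne_top) hμm.2
  have : IsFiniteMeasure μp := isFiniteMeasure_of_Icc (a := a) (b := b)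
    (by rw [hμp.1 b (right_mem_Icc.2 hab.le)]; exact ENNReal.ofReal_ne_top) hμp.2
  have ham := left_le_Mminus a X
  have hmb := Mminus_lt_right hab hX
  have hap := left_lt_Mplus hab hX
  have hpb := Mplus_le_right b X
  have hm : μm.real (Icc (Mplus b X) b) = lm (Mplus b X) := by
    rw [Measure.real, hμm.1 _ ⟨hap.le, hpb⟩, ENNReal.toReal_ofReal (h0m _ ⟨hap.le, hpb⟩)]
  have hp : μp.real (Icc a (Mminus a X)) = lp (Mminus a X) := by
    rw [Measure.real, hμp.1 _ ⟨ham, hmb.le⟩, ENNReal.toReal_ofReal (h0p _ ⟨ham, hmb.le⟩)]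
  have hIm := integral_indicator_add_const (μ := μm) measurableSet_Ioo measurableSet_Icc
    ((hvm.integrableOn_Icc hCm μm).mono_set
      (Ioo_subset_Icc_self.trans (Icc_subset_Icc_right hpb)))
    (Filter.mem_of_superset (mem_ae_iff.2 hμm.2) fun u hu => linF_Lminus_sub hab hX hwp hu)
  have hIp := integral_indicator_add_const (μ := μp) measurableSet_Ioc measurableSet_Icc
    ((hvp.integrableOn_Icc hCp μp).mono_set
      (Ioc_subset_Icc_self.trans (Icc_subset_Icc_left ham)))
    (Filter.mem_of_superset (mem_ae_iff.2 hμp.2) fun u hu => linF_Lplus_sub hab hX hwm hwp hu)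
  have : NullSingletonClass (μm.restrict (Ico a b)) :=
    ⟨fun x => (measureReal_eq_zero_iff).1 (hμm.restrict_real_singleton hcm h0m x)⟩
  rw [genOp, hIm, hIp, hm, hp, hνlp.eq_toSignedMeasure hab.le hcp h0p hμp,
    hνlm.eq_neg_toSignedMeasure hab.le hcm h0m hμm, sInt_toSignedMeasure,
    sInt_neg_toSignedMeasure, integral_Ioc_eq_integral_Ioo (μ := μm.restrict (Ico a b)),
    Measure.restrict_restrict measurableSet_Ioc, Measure.restrict_restrict measurableSet_Ioo,
    inter_eq_left.2 (Ioc_subset_Ioc_left ham),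
    inter_eq_left.2 (Ioo_subset_Ico_self.trans (Ico_subset_Ico_right hpb))]
  ring
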